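/- For each fixed real b with 0 < b < 1 there exist constants C > 0 and M > 0 such that for all a < -M: (1/C)·(-a)^{-1/4} ≤ A₂(a,b) ≤ C·(-a)^{-1/4}, (1/C)·(-a)^{-1/4} ≤ B₂(a,b) ≤ C·(-a)^{-1/4}, (1/C)·(-a)^{-1/2} ≤ C₂(a,b) ≤ C·(-a)^{-1/2}, and (1/C)·(-a)^{-1/2} ≤ E₂(a,b) ≤ C·(-a)^{-1/2}. (Asymptotic orders of the φ₂-period integrals as a → -∞.) -/

import Mathlib

open MeasureTheory Set

/-- A₁(a,b) = ∫_a^0 (z-a)^{1/2}(-z)^{-3/4}(b-z)^{-3/4}(1-z)^{-3/4} dz -/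
noncomputable def A1 (a b : ℝ) : ℝ :=
  ∫ z in Ioo a 0, (z - a) ^ ((1:ℝ)/2) * (-z) ^ (-(3:ℝ)/4) * (b - z) ^ (-(3:ℝ)/4) * (1 - z) ^ (-(3:ℝ)/4)

/-- B₁(a,b) = ∫_{-∞}^a (a-z)^{1/2}(-z)^{-3/4}(b-z)^{-3/4}(1-z)^{-3/4} dz -/
noncomputable def B1 (a b : ℝ) : ℝ :=
  ∫ z in Iio a, (a - z) ^ ((1:ℝ)/2) * (-z) ^ (-(3:ℝ)/4) * (b - z) ^ (-(3:ℝ)/4) * (1 - z) ^ (-(3:ℝ)/4)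

/-- C₁(a,b) = ∫_b^1 (z-a)^{1/2} z^{-3/4}(z-b)^{-3/4}(1-z)^{-3/4} dz -/
noncomputable def C1 (a b : ℝ) : ℝ :=
  ∫ z in Ioo b 1, (z - a) ^ ((1:ℝ)/2) * z ^ (-(3:ℝ)/4) * (z - b) ^ (-(3:ℝ)/4) * (1 - z) ^ (-(3:ℝ)/4)

/-- A₂(a,b) = ∫_a^0 (z-a)^{-1/2}(-z)^{-1/4}(b-z)^{-1/4}(1-z)^{-1/4} dz -/
noncomputable def A2 (a b : ℝ) : ℝ :=
  ∫ z in Ioo a 0, (z - a) ^ (-(1:ℝ)/2) * (-z) ^ (-(1:ℝ)/4) * (b - z) ^ (-(1:ℝ)/4) * (1 - z) ^ (-(1:ℝ)/4)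

/-- B₂(a,b) = ∫_{-∞}^a (a-z)^{-1/2}(-z)^{-1/4}(b-z)^{-1/4}(1-z)^{-1/4} dz -/
noncomputable def B2 (a b : ℝ) : ℝ :=
  ∫ z in Iio a, (a - z) ^ (-(1:ℝ)/2) * (-z) ^ (-(1:ℝ)/4) * (b - z) ^ (-(1:ℝ)/4) * (1 - z) ^ (-(1:ℝ)/4)

/-- C₂(a,b) = ∫_b^1 (z-a)^{-1/2} z^{-1/4}(z-b)^{-1/4}(1-z)^{-1/4} dz -/
noncomputable def C2 (a b : ℝ) : ℝ :=
  ∫ z in Ioo b 1, (z - a) ^ (-(1:ℝ)/2) * z ^ (-(1:ℝ)/4) * (z - b) ^ (-(1:ℝ)/4) * (1 - z) ^ (-(1:ℝ)/4)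

/-- E₂(a,b) = (1/√2)·∫_0^b (z-a)^{-1/2} z^{-1/4}(b-z)^{-1/4}(1-z)^{-1/4} dz -/
noncomputable def E2 (a b : ℝ) : ℝ :=
  (1 / Real.sqrt 2) *
    ∫ z in Ioo 0 b, (z - a) ^ (-(1:ℝ)/2) * z ^ (-(1:ℝ)/4) * (b - z) ^ (-(1:ℝ)/4) * (1 - z) ^ (-(1:ℝ)/4)

theorem IntegrableOn.of_nonneg_of_le {f g : ℝ → ℝ} {s : Set ℝ} (hs : MeasurableSet s)
    (hf : Measurable f) (hg : IntegrableOn g s) (h0 : ∀ z ∈ s, 0 ≤ f z)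
    (hfg : ∀ z ∈ s, f z ≤ g z) : IntegrableOn f s := by
  refine Integrable.mono' hg hf.aestronglyMeasurable ?_
  filter_upwards [ae_restrict_mem hs] with z hz
  rw [Real.norm_of_nonneg (h0 z hz)]
  exact hfg z hz

theorem integrableOn_sub_left_rpow {c d p : ℝ} (hcd : c < d) (hp : -1 < p) :
    IntegrableOn (fun z => (z - c) ^ p) (Ioo c d) := by
  have h := (intervalIntegral.intervalIntegrable_rpow' (a := 0) (b := d - c) hp).comp_sub_right c
  rw [zero_add, sub_add_cancel, intervalIntegrable_iff_integrableOn_Ioo_of_le hcd.le] at h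
  exact h

theorem integral_sub_left_rpow {c d p : ℝ} (hcd : c < d) (hp : -1 < p) :
    ∫ z in Ioo c d, (z - c) ^ p = (d - c) ^ (p + 1) / (p + 1) := by
  rw [← integral_Ioc_eq_integral_Ioo, ← intervalIntegral.integral_of_le hcd.le,
    intervalIntegral.integral_comp_sub_right (fun x => x ^ p), integral_rpow (Or.inl hp), sub_self,
    Real.zero_rpow (by linarith), sub_zero]

theorem integrableOn_sub_right_rpow {c d p : ℝ} (hcd : c < d) (hp : -1 < p) :
    IntegrableOn (fun z => (d - z) ^ p) (Ioo c d) := by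
  have h := (intervalIntegral.intervalIntegrable_rpow' (a := d - c) (b := 0) hp).comp_sub_left d
  rw [sub_zero, sub_sub_cancel, intervalIntegrable_iff_integrableOn_Ioo_of_le hcd.le] at h
  exact h

theorem integral_sub_right_rpow {c d p : ℝ} (hcd : c < d) (hp : -1 < p) :
    ∫ z in Ioo c d, (d - z) ^ p = (d - c) ^ (p + 1) / (p + 1) := by
  rw [← integral_Ioc_eq_integral_Ioo, ← intervalIntegral.integral_of_le hcd.le,
    intervalIntegral.integral_comp_sub_left (fun x => x ^ p), integral_rpow (Or.inl hp), sub_self,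
    Real.zero_rpow (by linarith), sub_zero]

theorem rpow_mul_rpow_le_add {x y p q : ℝ} (hx : 0 < x) (hy : 0 < y) (hp : p ≤ 0) (hq : q ≤ 0) :
    x ^ p * y ^ q ≤ ((x + y) / 2) ^ p * y ^ q + ((x + y) / 2) ^ q * x ^ p := by
  have hxp := Real.rpow_nonneg hx.le p
  have hyq := Real.rpow_nonneg hy.le q
  have hp' : 0 ≤ ((x + y) / 2) ^ p := by positivity
  have hq' : 0 ≤ ((x + y) / 2) ^ q := by positivity
  rcases le_total x y with h | h
  · have : y ^ q ≤ ((x + y) / 2) ^ q :=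
      Real.rpow_le_rpow_of_nonpos (by positivity) (by linarith) hq
    nlinarith [mul_le_mul_of_nonneg_left this hxp, mul_nonneg hp' hyq]
  · have : x ^ p ≤ ((x + y) / 2) ^ p :=
      Real.rpow_le_rpow_of_nonpos (by positivity) (by linarith) hp
    nlinarith [mul_le_mul_of_nonneg_right this hyq, mul_nonneg hq' hxp]

theorem integrableOn_rpow_mul_rpow {c d p q : ℝ} (hcd : c < d) (hp : -1 < p) (hp0 : p ≤ 0)
    (hq : -1 < q) (hq0 : q ≤ 0) :
    IntegrableOn (fun z => (z - c) ^ p * (d - z) ^ q) (Ioo c d) := by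
  refine IntegrableOn.of_nonneg_of_le measurableSet_Ioo (by fun_prop)
    (((integrableOn_sub_right_rpow hcd hq).const_mul (((d - c) / 2) ^ p)).add
      ((integrableOn_sub_left_rpow hcd hp).const_mul (((d - c) / 2) ^ q))) ?_ ?_
  · rintro z ⟨h1, h2⟩
    exact mul_nonneg (Real.rpow_nonneg (by linarith) _) (Real.rpow_nonneg (by linarith) _)
  · rintro z ⟨h1, h2⟩
    have := rpow_mul_rpow_le_add (sub_pos.2 h1) (sub_pos.2 h2) hp0 hq0
    simpa using this

theorem integral_rpow_mul_rpow_le {c d p q : ℝ} (hcd : c < d) (hp : -1 < p) (hp0 : p ≤ 0)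
    (hq : -1 < q) (hq0 : q ≤ 0) :
    ∫ z in Ioo c d, (z - c) ^ p * (d - z) ^ q ≤
      ((1 / 2) ^ p / (q + 1) + (1 / 2) ^ q / (p + 1)) * (d - c) ^ (p + q + 1) := by
  have hr := (integrableOn_sub_right_rpow hcd hq).const_mul (((d - c) / 2) ^ p)
  have hl := (integrableOn_sub_left_rpow hcd hp).const_mul (((d - c) / 2) ^ q)
  have hd : 0 < d - c := sub_pos.2 hcd
  calc ∫ z in Ioo c d, (z - c) ^ p * (d - z) ^ q
      ≤ ∫ z in Ioo c d, (((d - c) / 2) ^ p * (d - z) ^ q + ((d - c) / 2) ^ q * (z - c) ^ p) := by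
        refine setIntegral_mono_on (integrableOn_rpow_mul_rpow hcd hp hp0 hq hq0) (hr.add hl)
          measurableSet_Ioo ?_
        rintro z ⟨h1, h2⟩
        have := rpow_mul_rpow_le_add (sub_pos.2 h1) (sub_pos.2 h2) hp0 hq0
        simpa using this
    _ = _ := by
        rw [integral_add hr hl, integral_const_mul, integral_const_mul,
          integral_sub_left_rpow hcd hp, integral_sub_right_rpow hcd hq, div_eq_mul_one_div (d - c),
          Real.mul_rpow hd.le (by norm_num), Real.mul_rpow hd.le (by norm_num),
          Real.rpow_add hd p, Real.rpow_add hd q, Real.rpow_add hd (p + q), Real.rpow_add hd p]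
        ring

theorem rpow_neg_quarter_mul_le {x y z : ℝ} (hx : 0 < x) (hy : x ≤ y) (hz : x ≤ z) :
    x ^ (-(1 : ℝ) / 4) * y ^ (-(1 : ℝ) / 4) * z ^ (-(1 : ℝ) / 4) ≤ x ^ (-(3 : ℝ) / 4) := by
  have h1 := Real.rpow_le_rpow_of_nonpos hx hy (z := -(1 : ℝ) / 4) (by norm_num)
  have h2 := Real.rpow_le_rpow_of_nonpos hx hz (z := -(1 : ℝ) / 4) (by norm_num)
  have h3 : x ^ (-(3 : ℝ) / 4) =
      x ^ (-(1 : ℝ) / 4) * x ^ (-(1 : ℝ) / 4) * x ^ (-(1 : ℝ) / 4) := by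
    rw [← Real.rpow_add hx, ← Real.rpow_add hx]; norm_num
  have hy0 : 0 < y := by linarith
  have hz0 : 0 < z := by linarith
  rw [h3]
  gcongr

/-- A lower bound for an integrand of the type occurring in `A2` and `B2` over an interval
of length `N`, all four factors having base at most `3 * N`. -/
theorem le_integral_of_bases_le {c N : ℝ} (hN : 0 < N) {u v w x : ℝ → ℝ}
    (hu : ∀ z ∈ Ioo c (c + N), 0 < u z ∧ u z ≤ 3 * N)
    (hv : ∀ z ∈ Ioo c (c + N), 0 < v z ∧ v z ≤ 3 * N)
    (hw : ∀ z ∈ Ioo c (c + N), 0 < w z ∧ w z ≤ 3 * N)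
    (hx : ∀ z ∈ Ioo c (c + N), 0 < x z ∧ x z ≤ 3 * N)
    (hint : IntegrableOn (fun z => u z ^ (-(1 : ℝ) / 2) * v z ^ (-(1 : ℝ) / 4) *
      w z ^ (-(1 : ℝ) / 4) * x z ^ (-(1 : ℝ) / 4)) (Ioo c (c + N))) :
    3 ^ (-(5 : ℝ) / 4) * N ^ (-(1 : ℝ) / 4) ≤
      ∫ z in Ioo c (c + N), u z ^ (-(1 : ℝ) / 2) * v z ^ (-(1 : ℝ) / 4) *
        w z ^ (-(1 : ℝ) / 4) * x z ^ (-(1 : ℝ) / 4) := by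
  have h3 : (0 : ℝ) < 3 * N := by positivity
  have hprod : (3 * N) ^ (-(5 : ℝ) / 4) = (3 * N) ^ (-(1 : ℝ) / 2) * (3 * N) ^ (-(1 : ℝ) / 4) *
      (3 * N) ^ (-(1 : ℝ) / 4) * (3 * N) ^ (-(1 : ℝ) / 4) := by
    rw [← Real.rpow_add h3, ← Real.rpow_add h3, ← Real.rpow_add h3]; norm_num
  calc 3 ^ (-(5 : ℝ) / 4) * N ^ (-(1 : ℝ) / 4)
      = ∫ _ in Ioo c (c + N), (3 * N) ^ (-(5 : ℝ) / 4) := by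
        rw [setIntegral_const, measureReal_def, Real.volume_Ioo, add_sub_cancel_left,
          ENNReal.toReal_ofReal hN.le, smul_eq_mul, Real.mul_rpow (by norm_num) hN.le,
          show (-(1 : ℝ) / 4) = 1 + -(5 : ℝ) / 4 by norm_num, Real.rpow_add hN, Real.rpow_one]
        ring
    _ ≤ _ := by
        refine setIntegral_mono_on (by simp) hint measurableSet_Ioo fun z hz => ?_
        have key {y p : ℝ} (hp : p ≤ 0) (hy : 0 < y ∧ y ≤ 3 * N) : (3 * N) ^ p ≤ y ^ p :=
          Real.rpow_le_rpow_of_nonpos hy.1 hy.2 hp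
        have h1 := key (p := -(1 : ℝ) / 2) (by norm_num) (hu z hz)
        have h2 := key (p := -(1 : ℝ) / 4) (by norm_num) (hv z hz)
        have h3 := key (p := -(1 : ℝ) / 4) (by norm_num) (hw z hz)
        have h4 := key (p := -(1 : ℝ) / 4) (by norm_num) (hx z hz)
        have := (hu z hz).1
        have := (hv z hz).1
        have := (hw z hz).1
        rw [hprod]
        gcongr

theorem A2_bounds {b : ℝ} (hb : 0 < b) (hb1 : b < 1) : ∃ k K : ℝ, 0 < k ∧ 0 < K ∧ ∀ a < -1,
    k * (-a) ^ (-(1 : ℝ) / 4) ≤ A2 a b ∧ A2 a b ≤ K * (-a) ^ (-(1 : ℝ) / 4) := by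
  refine ⟨3 ^ (-(5 : ℝ) / 4), (1 / 2) ^ (-(1 : ℝ) / 2) / (-(3 : ℝ) / 4 + 1) +
    (1 / 2) ^ (-(3 : ℝ) / 4) / (-(1 : ℝ) / 2 + 1), by positivity, ?_, fun a ha => ?_⟩
  · have : (0 : ℝ) < -(3 : ℝ) / 4 + 1 := by norm_num
    have : (0 : ℝ) < -(1 : ℝ) / 2 + 1 := by norm_num
    positivity
  have ha0 : a < 0 := by linarith
  have hle : ∀ z ∈ Ioo a 0, (z - a) ^ (-(1 : ℝ) / 2) * (-z) ^ (-(1 : ℝ) / 4) *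
      (b - z) ^ (-(1 : ℝ) / 4) * (1 - z) ^ (-(1 : ℝ) / 4) ≤
      (z - a) ^ (-(1 : ℝ) / 2) * (0 - z) ^ (-(3 : ℝ) / 4) := by
    rintro z ⟨h1, h2⟩
    have := rpow_neg_quarter_mul_le (x := -z) (y := b - z) (z := 1 - z) (by linarith)
      (by linarith) (by linarith)
    have h0 : 0 < z - a := by linarith
    rw [zero_sub, mul_assoc, mul_assoc, ← mul_assoc ((-z) ^ _)]
    gcongr
  have hg := integrableOn_rpow_mul_rpow ha0 (p := -(1 : ℝ) / 2) (q := -(3 : ℝ) / 4)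
    (by norm_num) (by norm_num) (by norm_num) (by norm_num)
  have hint := IntegrableOn.of_nonneg_of_le measurableSet_Ioo (by fun_prop) hg
    (fun z ⟨h1, h2⟩ => by
      have : 0 < z - a := by linarith
      have : 0 < -z := by linarith
      have : 0 < b - z := by linarith
      have : 0 < 1 - z := by linarith
      positivity) hle
  constructor
  · have := le_integral_of_bases_le (c := a) (N := -a) (u := fun z => z - a) (v := fun z => -z)
      (w := fun z => b - z) (x := fun z => 1 - z) (by linarith)
      (fun z ⟨_, _⟩ => ⟨by linarith, by linarith⟩) (fun z ⟨_, _⟩ => ⟨by linarith, by linarith⟩)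
      (fun z ⟨_, _⟩ => ⟨by linarith, by linarith⟩) (fun z ⟨_, _⟩ => ⟨by linarith, by linarith⟩)
      (by rwa [add_neg_cancel])
    rwa [add_neg_cancel] at this
  · refine (setIntegral_mono_on hint hg measurableSet_Ioo hle).trans ?_
    refine (integral_rpow_mul_rpow_le ha0 (by norm_num) (by norm_num) (by norm_num)
      (by norm_num)).trans_eq ?_
    rw [zero_sub, show -(1 : ℝ) / 2 + -(3 : ℝ) / 4 + 1 = -(1 : ℝ) / 4 by norm_num]

theorem B2_bounds {b : ℝ} (hb : 0 < b) (hb1 : b < 1) : ∃ k K : ℝ, 0 < k ∧ 0 < K ∧ ∀ a < -1,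
    k * (-a) ^ (-(1 : ℝ) / 4) ≤ B2 a b ∧ B2 a b ≤ K * (-a) ^ (-(1 : ℝ) / 4) := by
  refine ⟨3 ^ (-(5 : ℝ) / 4), 4 * ((1 / 2) ^ (-(1 : ℝ) / 2) * 2 ^ (-(1 : ℝ) / 4)) + 2,
    by positivity, by positivity, fun a ha => ?_⟩
  have ha0 : 0 < -a := by linarith
  set f : ℝ → ℝ := fun z => (a - z) ^ (-(1 : ℝ) / 2) * (-z) ^ (-(1 : ℝ) / 4) *
    (b - z) ^ (-(1 : ℝ) / 4) * (1 - z) ^ (-(1 : ℝ) / 4) with hf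
  have hfm : Measurable f := by fun_prop
  have hf0 : ∀ z < a, 0 ≤ f z := fun z hz => by
    have : 0 < a - z := by linarith
    have : 0 < -z := by linarith
    have : 0 < b - z := by linarith
    have : 0 < 1 - z := by linarith
    positivity
  have hle : ∀ z < a, f z ≤ (a - z) ^ (-(1 : ℝ) / 2) * (-z) ^ (-(3 : ℝ) / 4) := by
    intro z hz
    have := rpow_neg_quarter_mul_le (x := -z) (y := b - z) (z := 1 - z) (by linarith)
      (by linarith) (by linarith)
    have h0 : 0 < a - z := by linarith
    simp only [hf]
    rw [mul_assoc, mul_assoc, ← mul_assoc ((-z) ^ _)]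
    gcongr
  have hle₁ : ∀ z ∈ Ioo (2 * a) a, f z ≤ (-a) ^ (-(3 : ℝ) / 4) * (a - z) ^ (-(1 : ℝ) / 2) := by
    rintro z ⟨h1, h2⟩
    refine (hle z h2).trans ?_
    have := Real.rpow_le_rpow_of_nonpos ha0 (y := -z) (x := -a) (z := -(3 : ℝ) / 4)
      (by linarith) (by norm_num)
    have h0 : 0 < a - z := by linarith
    rw [mul_comm]
    gcongr
  have hle₂ : ∀ z ∈ Iic (2 * a), f z ≤ (1 / 2) ^ (-(1 : ℝ) / 2) * (-z) ^ (-(5 : ℝ) / 4) := by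
    intro z (hz : z ≤ 2 * a)
    have hz0 : 0 < -z := by linarith
    refine (hle z (by linarith)).trans ?_
    have := Real.rpow_le_rpow_of_nonpos (x := 1 / 2 * (-z)) (y := a - z)
      (z := -(1 : ℝ) / 2) (by linarith) (by linarith) (by norm_num)
    rw [show -(5 : ℝ) / 4 = -(1 : ℝ) / 2 + -(3 : ℝ) / 4 by norm_num, Real.rpow_add hz0, ← mul_assoc,
      ← Real.mul_rpow (by norm_num) hz0.le]
    gcongr
  have hg₁ := (integrableOn_sub_right_rpow (c := 2 * a) (d := a) (p := -(1 : ℝ) / 2) (by linarith)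
    (by norm_num)).const_mul ((-a) ^ (-(3 : ℝ) / 4))
  have hg₂ : IntegrableOn (fun z : ℝ => (1 / 2) ^ (-(1 : ℝ) / 2) * (-z) ^ (-(5 : ℝ) / 4))
      (Iic (2 * a)) := by
    have h := integrableOn_Ioi_rpow_of_lt (a := -(5 : ℝ) / 4) (c := -(2 * a)) (by norm_num)
      (by linarith)
    exact (((integrableOn_Ici_iff_integrableOn_Ioi).2 h).comp_neg_Iic).const_mul _
  have hf₁ := IntegrableOn.of_nonneg_of_le measurableSet_Ioo hfm hg₁ (fun z hz => hf0 z hz.2) hle₁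
  have hf₂ := IntegrableOn.of_nonneg_of_le measurableSet_Iic hfm hg₂
    (fun z hz => hf0 z (lt_of_le_of_lt hz (by linarith))) hle₂
  have hsplit : B2 a b = (∫ z in Iic (2 * a), f z) + ∫ z in Ioo (2 * a) a, f z := by
    rw [← setIntegral_union _ measurableSet_Ioo hf₂ hf₁, Iic_union_Ioo_eq_Iio (by linarith)]
    · rfl
    · exact Set.disjoint_left.2 fun z (h : z ≤ 2 * a) h' => not_lt.2 h h'.1
  rw [hsplit]
  constructor
  · have := le_integral_of_bases_le (c := 2 * a) (N := -a) (u := fun z => a - z) (v := fun z => -z)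
      (w := fun z => b - z) (x := fun z => 1 - z) (by linarith)
      (fun z ⟨_, _⟩ => ⟨by linarith, by linarith⟩) (fun z ⟨_, _⟩ => ⟨by linarith, by linarith⟩)
      (fun z ⟨_, _⟩ => ⟨by linarith, by linarith⟩) (fun z ⟨_, _⟩ => ⟨by linarith, by linarith⟩)
      (by rwa [show 2 * a + -a = a by ring])
    rw [show 2 * a + -a = a by ring] at this
    have h0 : 0 ≤ ∫ z in Iic (2 * a), f z := setIntegral_nonneg measurableSet_Iic
      fun z hz => hf0 z (lt_of_le_of_lt hz (by linarith))
    exact this.trans (le_add_of_nonneg_left h0)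
  · rw [add_mul]
    refine add_le_add ((setIntegral_mono_on hf₂ hg₂ measurableSet_Iic hle₂).trans_eq ?_)
      ((setIntegral_mono_on hf₁ hg₁ measurableSet_Ioo hle₁).trans_eq ?_)
    · rw [integral_const_mul, integral_comp_neg_Iic (2 * a) (fun x => x ^ (-(5 : ℝ) / 4)),
        integral_Ioi_rpow_of_lt (by norm_num) (by linarith),
        show -(5 : ℝ) / 4 + 1 = -(1 : ℝ) / 4 by norm_num, show -(2 * a) = 2 * -a by ring,
        Real.mul_rpow (by norm_num) ha0.le]
      ring
    · rw [integral_const_mul, integral_sub_right_rpow (by linarith) (by norm_num),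
        show a - 2 * a = -a by ring, show -(1 : ℝ) / 4 = -(3 : ℝ) / 4 + (-(1 : ℝ) / 2 + 1) by
          norm_num, Real.rpow_add ha0 (-(3 : ℝ) / 4)]
      ring

/-- Integrating a fixed positive weight on a subinterval of `(0, 1)` against `(z - a) ^ (-1 / 2)`
gives a quantity of order `(-a) ^ (-1 / 2)` as `a → -∞`. -/
theorem integral_rpow_mul_bounds {c d : ℝ} (hc : 0 ≤ c) (hcd : c < d) (hd : d ≤ 1) {h : ℝ → ℝ}
    (hm : Measurable h) (hpos : ∀ z ∈ Ioo c d, 0 < h z) (hint : IntegrableOn h (Ioo c d)) :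
    ∃ k K : ℝ, 0 < k ∧ 0 < K ∧ ∀ a < -1,
      k * (-a) ^ (-(1 : ℝ) / 2) ≤ ∫ z in Ioo c d, (z - a) ^ (-(1 : ℝ) / 2) * h z ∧
      ∫ z in Ioo c d, (z - a) ^ (-(1 : ℝ) / 2) * h z ≤ K * (-a) ^ (-(1 : ℝ) / 2) := by
  have hI : 0 < ∫ z in Ioo c d, h z := by
    rw [← integral_Ioc_eq_integral_Ioo, ← intervalIntegral.integral_of_le hcd.le]
    exact intervalIntegral.intervalIntegral_pos_of_pos_on
      ((intervalIntegrable_iff_integrableOn_Ioo_of_le hcd.le).2 hint) hpos hcd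
  refine ⟨2 ^ (-(1 : ℝ) / 2) * ∫ z in Ioo c d, h z, ∫ z in Ioo c d, h z, by positivity, hI,
    fun a ha => ?_⟩
  have ha0 : 0 < -a := by linarith
  have hup : ∀ z ∈ Ioo c d, (z - a) ^ (-(1 : ℝ) / 2) * h z ≤ (-a) ^ (-(1 : ℝ) / 2) * h z :=
    fun z hz => mul_le_mul_of_nonneg_right (Real.rpow_le_rpow_of_nonpos ha0
      (by linarith [hz.1]) (by norm_num)) (hpos z hz).le
  have hlow : ∀ z ∈ Ioo c d, (2 * -a) ^ (-(1 : ℝ) / 2) * h z ≤ (z - a) ^ (-(1 : ℝ) / 2) * h z :=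
    fun z hz => mul_le_mul_of_nonneg_right (Real.rpow_le_rpow_of_nonpos
      (by linarith [hz.1]) (by linarith [hz.2]) (by norm_num)) (hpos z hz).le
  have hi := IntegrableOn.of_nonneg_of_le measurableSet_Ioo (by fun_prop) (hint.const_mul _)
    (fun z hz => mul_nonneg (Real.rpow_nonneg (by linarith [hz.1]) _) (hpos z hz).le) hup
  constructor
  · refine le_trans (le_of_eq ?_)
      (setIntegral_mono_on (hint.const_mul _) hi measurableSet_Ioo hlow)
    rw [integral_const_mul, Real.mul_rpow (by norm_num) ha0.le]
    ring
  · refine (setIntegral_mono_on hi (hint.const_mul _) measurableSet_Ioo hup).trans_eq ?_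
    rw [integral_const_mul, mul_comm]

theorem C2_bounds {b : ℝ} (hb : 0 < b) (hb1 : b < 1) : ∃ k K : ℝ, 0 < k ∧ 0 < K ∧ ∀ a < -1,
    k * (-a) ^ (-(1 : ℝ) / 2) ≤ C2 a b ∧ C2 a b ≤ K * (-a) ^ (-(1 : ℝ) / 2) := by
  have hpos : ∀ z ∈ Ioo b 1,
      0 < z ^ (-(1 : ℝ) / 4) * ((z - b) ^ (-(1 : ℝ) / 4) * (1 - z) ^ (-(1 : ℝ) / 4)) := by
    rintro z ⟨h1, h2⟩
    have : 0 < z := by linarith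
    have : 0 < z - b := by linarith
    have : 0 < 1 - z := by linarith
    positivity
  simp only [C2, mul_assoc]
  refine integral_rpow_mul_bounds hb.le hb1 le_rfl (by fun_prop) hpos
    (IntegrableOn.of_nonneg_of_le measurableSet_Ioo (by fun_prop)
      ((integrableOn_rpow_mul_rpow (p := -(1 : ℝ) / 4) (q := -(1 : ℝ) / 4) hb1 (by norm_num) (by norm_num) (by norm_num)
        (by norm_num)).const_mul (b ^ (-(1 : ℝ) / 4))) (fun z hz => (hpos z hz).le) ?_)
  rintro z ⟨h1, h2⟩
  have : 0 < z - b := by linarith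
  have : 0 < 1 - z := by linarith
  exact mul_le_mul_of_nonneg_right
    (Real.rpow_le_rpow_of_nonpos hb h1.le (by norm_num)) (by positivity)

theorem E2_bounds {b : ℝ} (hb : 0 < b) (hb1 : b < 1) : ∃ k K : ℝ, 0 < k ∧ 0 < K ∧ ∀ a < -1,
    k * (-a) ^ (-(1 : ℝ) / 2) ≤ E2 a b ∧ E2 a b ≤ K * (-a) ^ (-(1 : ℝ) / 2) := by
  have hpos : ∀ z ∈ Ioo 0 b,
      0 < z ^ (-(1 : ℝ) / 4) * ((b - z) ^ (-(1 : ℝ) / 4) * (1 - z) ^ (-(1 : ℝ) / 4)) := by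
    rintro z ⟨h1, h2⟩
    have : 0 < b - z := by linarith
    have : 0 < 1 - z := by linarith
    positivity
  obtain ⟨k, K, hk, hK, h⟩ := integral_rpow_mul_bounds le_rfl hb hb1.le (by fun_prop) hpos
    (IntegrableOn.of_nonneg_of_le measurableSet_Ioo (by fun_prop)
      ((integrableOn_rpow_mul_rpow (p := -(1 : ℝ) / 4) (q := -(1 : ℝ) / 4) hb (by norm_num) (by norm_num) (by norm_num)
        (by norm_num)).mul_const ((1 - b) ^ (-(1 : ℝ) / 4))) (fun z hz => (hpos z hz).le) (by
      rintro z ⟨h1, h2⟩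
      have : 0 < b - z := by linarith
      have := Real.rpow_le_rpow_of_nonpos (x := 1 - b) (y := 1 - z) (z := -(1 : ℝ) / 4)
        (by linarith) (by linarith) (by norm_num)
      rw [sub_zero, ← mul_assoc]
      gcongr))
  refine ⟨1 / √2 * k, 1 / √2 * K, by positivity, by positivity, fun a ha => ?_⟩
  obtain ⟨h1, h2⟩ := h a ha
  simp only [E2, mul_assoc]
  exact ⟨by gcongr, by gcongr⟩

theorem one_div_mul_le_and_le_mul {k K C X F : ℝ} (hk : 0 < k) (hX : 0 ≤ X) (hkC : 1 / k ≤ C)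
    (hKC : K ≤ C) (h : k * X ≤ F ∧ F ≤ K * X) : 1 / C * X ≤ F ∧ F ≤ C * X :=
  ⟨(mul_le_mul_of_nonneg_right ((one_div_le hk ((one_div_pos.2 hk).trans_le hkC)).1 hkC) hX).trans
    h.1, h.2.trans (mul_le_mul_of_nonneg_right hKC hX)⟩

theorem cs4_phi2_asymptotics_a_to_neg_infty :
    ∀ b : ℝ, 0 < b → b < 1 → ∃ C M : ℝ, 0 < C ∧ 0 < M ∧
      ∀ a : ℝ, a < -M →
        ((1 / C) * (-a) ^ (-(1:ℝ)/4) ≤ A2 a b ∧ A2 a b ≤ C * (-a) ^ (-(1:ℝ)/4)) ∧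
        ((1 / C) * (-a) ^ (-(1:ℝ)/4) ≤ B2 a b ∧ B2 a b ≤ C * (-a) ^ (-(1:ℝ)/4)) ∧
        ((1 / C) * (-a) ^ (-(1:ℝ)/2) ≤ C2 a b ∧ C2 a b ≤ C * (-a) ^ (-(1:ℝ)/2)) ∧
        ((1 / C) * (-a) ^ (-(1:ℝ)/2) ≤ E2 a b ∧ E2 a b ≤ C * (-a) ^ (-(1:ℝ)/2)) := by
  intro b hb hb1
  obtain ⟨k₁, K₁, hk₁, hK₁, h₁⟩ := A2_bounds hb hb1
  obtain ⟨k₂, K₂, hk₂, hK₂, h₂⟩ := B2_bounds hb hb1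
  obtain ⟨k₃, K₃, hk₃, hK₃, h₃⟩ := C2_bounds hb hb1
  obtain ⟨k₄, K₄, hk₄, hK₄, h₄⟩ := E2_bounds hb hb1
  have := one_div_pos.2 hk₁
  have := one_div_pos.2 hk₂
  have := one_div_pos.2 hk₃
  have := one_div_pos.2 hk₄
  refine ⟨1 / k₁ + K₁ + (1 / k₂ + K₂) + (1 / k₃ + K₃) + (1 / k₄ + K₄), 1, by positivity,
    one_pos, fun a ha => ?_⟩
  have hX (p : ℝ) : 0 ≤ (-a) ^ p := Real.rpow_nonneg (by linarith) p
  exact ⟨one_div_mul_le_and_le_mul hk₁ (hX _) (by linarith) (by linarith) (h₁ a ha),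
    one_div_mul_le_and_le_mul hk₂ (hX _) (by linarith) (by linarith) (h₂ a ha),
    one_div_mul_le_and_le_mul hk₃ (hX _) (by linarith) (by linarith) (h₃ a ha),
    one_div_mul_le_and_le_mul hk₄ (hX _) (by linarith) (by linarith) (h₄ a ha)⟩
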